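/- Let n ≥ 4, let B be a blocker for the triangulations of a convex n-gon, and let i ∈ ZMod n be a vertex such that at least two diagonals of B have i as an endpoint. Then the ear-cover {i−1, i+1} belongs to B. -/

import Mathlib

namespace ConvexBlockers

/-- Cyclic distance between two vertices of the convex `n`-gon (vertices = `ZMod n`). -/
def cyclicDist {n : ℕ} (i j : ZMod n) : ℕ := min (i - j).val (j - i).val

/-- A diagonal: an unordered pair of vertices at cyclic distance at least 2. -/
def IsDiagonal {n : ℕ} (e : Sym2 (ZMod n)) : Prop :=
  ∃ i j : ZMod n, e = s(i, j) ∧ 2 ≤ cyclicDist i j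

/-- An ear-cover: a diagonal of cyclic distance exactly 2. -/
def IsEarCover {n : ℕ} (e : Sym2 (ZMod n)) : Prop :=
  ∃ i j : ZMod n, e = s(i, j) ∧ cyclicDist i j = 2

/-- `Btw a x b` : `x` lies strictly inside the clockwise arc from `a` to `b`. -/
def Btw {n : ℕ} (a x b : ZMod n) : Prop :=
  0 < (x - a).val ∧ (x - a).val < (b - a).val

/-- Two diagonals cross iff their endpoint pairs strictly interleave in the cyclic order. -/
def Crosses {n : ℕ} (e f : Sym2 (ZMod n)) : Prop :=
  ∃ a b c d : ZMod n, e = s(a, b) ∧ f = s(c, d) ∧ Btw a c b ∧ Btw b d a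

/-- A triangulation: a maximal (w.r.t. inclusion) set of pairwise non-crossing diagonals. -/
def IsTriangulation {n : ℕ} (T : Set (Sym2 (ZMod n))) : Prop :=
  (∀ e ∈ T, IsDiagonal e) ∧
  (∀ e ∈ T, ∀ f ∈ T, ¬ Crosses e f) ∧
  (∀ T' : Set (Sym2 (ZMod n)), (∀ e ∈ T', IsDiagonal e) →
    (∀ e ∈ T', ∀ f ∈ T', ¬ Crosses e f) → T ⊆ T' → T' = T)

/-- A blocking set: a set of diagonals meeting every triangulation. -/
def IsBlockingSet {n : ℕ} (B : Set (Sym2 (ZMod n))) : Prop :=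
  (∀ e ∈ B, IsDiagonal e) ∧
  ∀ T : Set (Sym2 (ZMod n)), IsTriangulation T → (B ∩ T).Nonempty

/-- A blocker: a blocking set of minimum possible cardinality. -/
def IsBlocker {n : ℕ} (B : Set (Sym2 (ZMod n))) : Prop :=
  IsBlockingSet B ∧
  ∀ B' : Set (Sym2 (ZMod n)), IsBlockingSet B' → B.ncard ≤ B'.ncard

/-- Every vertex of the `n`-gon is reached from `p` by fewer than `n` clockwise steps. -/
lemma exists_eq_add_natCast {n : ℕ} [NeZero n] (p x : ZMod n) :
    ∃ a : ℕ, a < n ∧ x = p + a :=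
  ⟨(x - p).val, ZMod.val_lt _, by simp⟩

lemma add_natCast_injOn {n : ℕ} (p : ZMod n) {a b : ℕ} (ha : a < n) (hb : b < n)
    (h : p + (a : ZMod n) = p + b) : a = b := by
  have h' := congrArg ZMod.val (add_left_cancel h)
  rwa [ZMod.val_cast_of_lt ha, ZMod.val_cast_of_lt hb] at h'

lemma val_add_natCast_sub {n : ℕ} (p : ZMod n) {a b : ℕ} (ha : a < n) (hb : b < n) :
    ((p + a) - (p + b) : ZMod n).val = if b ≤ a then a - b else n + a - b := by
  rw [add_sub_add_left_eq_sub]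
  split_ifs with h
  · rw [← Nat.cast_sub h, ZMod.val_cast_of_lt (by omega)]
  · have : ((a : ZMod n) - b) = ((n + a - b : ℕ) : ZMod n) := by
      rw [Nat.cast_sub (by omega)]
      simp
    rw [this, ZMod.val_cast_of_lt (by omega)]

lemma cyclicDist_comm {n : ℕ} (i j : ZMod n) : cyclicDist i j = cyclicDist j i :=
  min_comm _ _

lemma isDiagonal_mk {n : ℕ} (i j : ZMod n) : IsDiagonal s(i, j) ↔ 2 ≤ cyclicDist i j := by
  constructor
  · rintro ⟨a, b, h, hd⟩
    rcases Sym2.eq_iff.1 h with ⟨rfl, rfl⟩ | ⟨rfl, rfl⟩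
    · exact hd
    · rwa [cyclicDist_comm]
  · exact fun h => ⟨i, j, rfl, h⟩

lemma isDiagonal_add_natCast {n : ℕ} (p : ZMod n) {a b : ℕ} (ha : a < n) (hb : b < n) :
    IsDiagonal s(p + (a : ZMod n), p + (b : ZMod n)) ↔
      (a + 2 ≤ b ∧ b + 2 ≤ a + n) ∨ (b + 2 ≤ a ∧ a + 2 ≤ b + n) := by
  rw [isDiagonal_mk, cyclicDist, val_add_natCast_sub p ha hb, val_add_natCast_sub p hb ha]
  split_ifs <;> omega

lemma btw_add_natCast {n : ℕ} (p : ZMod n) {a b c : ℕ} (ha : a < n) (hb : b < n) (hc : c < n) :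
    Btw (p + (a : ZMod n)) (p + (c : ZMod n)) (p + (b : ZMod n)) ↔
      (a < c ∧ c < b) ∨ (c < b ∧ b < a) ∨ (b < a ∧ a < c) := by
  rw [Btw, val_add_natCast_sub p hc ha, val_add_natCast_sub p hb ha]
  split_ifs <;> omega

/-- Crossing, in terms of the positions of the endpoints read clockwise from `p`. -/
lemma crosses_add_natCast {n : ℕ} (p : ZMod n) {a b c d : ℕ}
    (ha : a < n) (hb : b < n) (hc : c < n) (hd : d < n) :
    Crosses s(p + (a : ZMod n), p + (b : ZMod n)) s(p + (c : ZMod n), p + (d : ZMod n)) ↔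
      (min a b < min c d ∧ min c d < max a b ∧ max a b < max c d) ∨
      (min c d < min a b ∧ min a b < max c d ∧ max c d < max a b) := by
  constructor
  · rintro ⟨x, y, z, w, h₁, h₂, h₃, h₄⟩
    rcases Sym2.eq_iff.1 h₁ with ⟨rfl, rfl⟩ | ⟨rfl, rfl⟩ <;>
    rcases Sym2.eq_iff.1 h₂ with ⟨rfl, rfl⟩ | ⟨rfl, rfl⟩ <;>
    · rw [btw_add_natCast p (by assumption) (by assumption) (by assumption)] at h₃ h₄
      omega
  · intro h
    by_cases h' : Btw (p + (a : ZMod n)) (p + (c : ZMod n)) (p + (b : ZMod n)) ∧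
        Btw (p + (b : ZMod n)) (p + (d : ZMod n)) (p + (a : ZMod n))
    · exact ⟨_, _, _, _, rfl, rfl, h'⟩
    · refine ⟨_, _, _, _, Sym2.eq_swap, rfl, ?_⟩
      rw [btw_add_natCast p ha hb hc, btw_add_natCast p hb ha hd] at h'
      rw [btw_add_natCast p hb ha hc, btw_add_natCast p ha hb hd]
      omega

lemma Crosses.symm {n : ℕ} [NeZero n] {e f : Sym2 (ZMod n)} (h : Crosses e f) :
    Crosses f e := by
  induction e with | _ x y
  induction f with | _ z w
  obtain ⟨a, ha, rfl⟩ := exists_eq_add_natCast 0 x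
  obtain ⟨b, hb, rfl⟩ := exists_eq_add_natCast 0 y
  obtain ⟨c, hc, rfl⟩ := exists_eq_add_natCast 0 z
  obtain ⟨d, hd, rfl⟩ := exists_eq_add_natCast 0 w
  rw [crosses_add_natCast 0 ha hb hc hd] at h
  rw [crosses_add_natCast 0 hc hd ha hb]
  omega

lemma not_crosses_self {n : ℕ} [NeZero n] (e : Sym2 (ZMod n)) : ¬ Crosses e e := by
  induction e with | _ x y
  obtain ⟨a, ha, rfl⟩ := exists_eq_add_natCast 0 x
  obtain ⟨b, hb, rfl⟩ := exists_eq_add_natCast 0 y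
  rw [crosses_add_natCast 0 ha hb ha hb]
  omega

lemma isTriangulation_of_forall_mem {n : ℕ} {T : Set (Sym2 (ZMod n))}
    (h₁ : ∀ e ∈ T, IsDiagonal e) (h₂ : ∀ e ∈ T, ∀ f ∈ T, ¬ Crosses e f)
    (h₃ : ∀ e, IsDiagonal e → (∀ f ∈ T, ¬ Crosses e f) → e ∈ T) : IsTriangulation T :=
  ⟨h₁, h₂, fun _ hd hc hT =>
    (Set.Subset.antisymm hT fun e he => h₃ e (hd e he) fun f hf => hc e he f (hT hf)).symm⟩

lemma IsTriangulation.mem_of_forall_not_crosses {n : ℕ} [NeZero n] {T : Set (Sym2 (ZMod n))}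
    (hT : IsTriangulation T) {e : Sym2 (ZMod n)} (he : IsDiagonal e)
    (h : ∀ f ∈ T, ¬ Crosses e f) : e ∈ T := by
  have := hT.2.2 (insert e T) ?_ ?_ (Set.subset_insert _ _)
  · exact this ▸ Set.mem_insert _ _
  · rintro f (rfl | hf)
    exacts [he, hT.1 f hf]
  · rintro f (rfl | hf) g (rfl | hg)
    exacts [not_crosses_self _, h g hg, fun hc => h f hf hc.symm, hT.2.1 f hf g hg]

/-- The diagonals with endpoint `i`. -/
def fan {n : ℕ} (i : ZMod n) : Set (Sym2 (ZMod n)) := {e | IsDiagonal e ∧ i ∈ e}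

lemma exists_of_mem_fan {n : ℕ} [NeZero n] {i : ZMod n} {e : Sym2 (ZMod n)} (he : e ∈ fan i) :
    ∃ k ∈ Finset.Icc 2 (n - 2), e = s(i + ((0 : ℕ) : ZMod n), i + (k : ZMod n)) := by
  obtain ⟨hd, y, rfl⟩ := he
  obtain ⟨b, hb, rfl⟩ := exists_eq_add_natCast i y
  have hi : i = i + ((0 : ℕ) : ZMod n) := by simp
  refine ⟨b, ?_, by simp⟩
  nth_rewrite 1 [hi] at hd
  rw [isDiagonal_add_natCast i (NeZero.pos n) hb] at hd
  rw [Finset.mem_Icc]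
  omega

lemma isTriangulation_fan {n : ℕ} [NeZero n] (i : ZMod n) : IsTriangulation (fan i) := by
  have hn := NeZero.pos n
  refine isTriangulation_of_forall_mem (fun e he => he.1) ?_ ?_
  · intro e he f hf
    obtain ⟨k, hk, rfl⟩ := exists_of_mem_fan he
    obtain ⟨l, hl, rfl⟩ := exists_of_mem_fan hf
    rw [Finset.mem_Icc] at hk hl
    rw [crosses_add_natCast i hn (by omega) hn (by omega)]
    omega
  · intro e he h
    refine ⟨he, ?_⟩
    induction e with | _ x y
    obtain ⟨a, ha, rfl⟩ := exists_eq_add_natCast i x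
    obtain ⟨b, hb, rfl⟩ := exists_eq_add_natCast i y
    by_contra hi
    have ha0 : a ≠ 0 := by rintro rfl; simp at hi
    have hb0 : b ≠ 0 := by rintro rfl; simp at hi
    rw [isDiagonal_add_natCast i ha hb] at he
    have hk : min a b + 1 < n := by omega
    refine h s(i + ((0 : ℕ) : ZMod n), i + ((min a b + 1 : ℕ) : ZMod n)) ⟨?_, ?_⟩ ?_
    · rw [isDiagonal_add_natCast i hn hk]
      omega
    · simp
    · rw [crosses_add_natCast i ha hb hn hk]
      omega

lemma IsBlockingSet.exists_mem {n : ℕ} [NeZero n] {B : Set (Sym2 (ZMod n))}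
    (hB : IsBlockingSet B) (i : ZMod n) : ∃ e ∈ B, i ∈ e := by
  obtain ⟨e, he, hf⟩ := hB.2 _ (isTriangulation_fan i)
  exact ⟨e, he, hf.2⟩

lemma ear_eq {m : ℕ} (i : ZMod (m + 1)) (hm : 1 ≤ m) :
    s(i - 1, i + 1) = s(i + 1 + ((0 : ℕ) : ZMod (m + 1)),
      i + 1 + ((m - 1 : ℕ) : ZMod (m + 1))) := by
  rw [Sym2.eq_swap]
  have h : ((m + 1 : ℕ) : ZMod (m + 1)) = 0 := ZMod.natCast_self _
  push_cast [Nat.cast_sub hm] at h ⊢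
  have h' : i + 1 + ((m : ZMod (m + 1)) - 1) = i - 1 := by linear_combination h
  rw [h', add_zero]

lemma eq_add_one_add_natCast {m : ℕ} (i : ZMod (m + 1)) :
    i = i + 1 + (m : ZMod (m + 1)) := by
  have h : ((m + 1 : ℕ) : ZMod (m + 1)) = 0 := ZMod.natCast_self _
  push_cast at h
  linear_combination -h

/-- A fan together with the ear-cover of its apex is a blocking set. -/
lemma exists_isBlockingSet_ncard_le {m : ℕ} (hm : 3 ≤ m) :
    ∃ B : Set (Sym2 (ZMod (m + 1))), IsBlockingSet B ∧ B.ncard ≤ m - 1 := by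
  set i : ZMod (m + 1) := 0
  have hear : IsDiagonal s(i - 1, i + 1) := by
    rw [ear_eq i (by omega), isDiagonal_add_natCast _ (by omega) (by omega)]
    omega
  refine ⟨insert s(i - 1, i + 1) (fan i), ⟨?_, fun T hT => ?_⟩, ?_⟩
  · rintro e (rfl | he)
    exacts [hear, he.1]
  · by_cases h : ∃ e ∈ T, i ∈ e
    · obtain ⟨e, he, hi⟩ := h
      exact ⟨e, Or.inr ⟨hT.1 e he, hi⟩, he⟩
    · refine ⟨_, Or.inl rfl, hT.mem_of_forall_not_crosses hear fun f hf hc => h ⟨f, hf, ?_⟩⟩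
      induction f with | _ x y
      obtain ⟨a, ha, rfl⟩ := exists_eq_add_natCast (i + 1) x
      obtain ⟨b, hb, rfl⟩ := exists_eq_add_natCast (i + 1) y
      rw [ear_eq i (by omega), crosses_add_natCast _ (by omega) (by omega) ha hb] at hc
      obtain rfl | rfl : a = m ∨ b = m := by omega
      · rw [← eq_add_one_add_natCast]
        exact Sym2.mem_mk_left _ _
      · rw [← eq_add_one_add_natCast]
        exact Sym2.mem_mk_right _ _
  · have hsub : fan i ⊆ (fun k : ℕ => s(i + ((0 : ℕ) : ZMod (m + 1)), i + (k : ZMod (m + 1)))) ''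
        (Finset.Icc 2 (m + 1 - 2) : Finset ℕ) := by
      intro e he
      obtain ⟨k, hk, rfl⟩ := exists_of_mem_fan he
      exact ⟨k, hk, rfl⟩
    have h₁ := Set.ncard_le_ncard hsub (Set.toFinite _)
    have h₂ := Set.ncard_image_le (f := fun k : ℕ => s(i + ((0 : ℕ) : ZMod (m + 1)),
      i + (k : ZMod (m + 1)))) (Finset.finite_toSet (Finset.Icc 2 (m + 1 - 2)))
    rw [Set.ncard_coe_finset, Nat.card_Icc] at h₂
    have h₃ := Set.ncard_insert_le s(i - 1, i + 1) (fan i)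
    omega

/-- Cutting off a vertex whose ear-cover avoids a blocking set leaves a blocking set of the
smaller polygon. -/
lemma IsBlockingSet.exists_of_ear_notMem {m : ℕ} (hm : 3 ≤ m) {B : Set (Sym2 (ZMod (m + 1)))}
    (hB : IsBlockingSet B) {i : ZMod (m + 1)} (hi : s(i - 1, i + 1) ∉ B) :
    ∃ B' : Set (Sym2 (ZMod m)), IsBlockingSet B' ∧ B'.ncard ≤ {e ∈ B | i ∉ e}.ncard := by
  have : NeZero m := ⟨by omega⟩
  rw [ear_eq i (by omega)] at hi
  have hip := eq_add_one_add_natCast i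
  generalize i + 1 = p at hi hip
  let φ : ZMod m → ZMod (m + 1) := fun x => p + (x.val : ZMod (m + 1))
  have hlt (x : ZMod m) : x.val < m := ZMod.val_lt x
  have hφ : Function.Injective φ := fun x y h => ZMod.val_injective m
    (add_natCast_injOn p (by have := hlt x; omega) (by have := hlt y; omega) h)
  have hφc {a : ℕ} (ha : a < m) : φ (0 + (a : ZMod m)) = p + (a : ZMod (m + 1)) := by
    simp only [φ, zero_add, ZMod.val_cast_of_lt ha]
  have hcross (e f : Sym2 (ZMod m)) : Crosses (e.map φ) (f.map φ) ↔ Crosses e f := by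
    induction e with | _ x y
    induction f with | _ z w
    obtain ⟨a, ha, rfl⟩ := exists_eq_add_natCast 0 x
    obtain ⟨b, hb, rfl⟩ := exists_eq_add_natCast 0 y
    obtain ⟨c, hc, rfl⟩ := exists_eq_add_natCast 0 z
    obtain ⟨d, hd, rfl⟩ := exists_eq_add_natCast 0 w
    rw [Sym2.map_mk, Sym2.map_mk, hφc ha, hφc hb, hφc hc, hφc hd,
      crosses_add_natCast 0 ha hb hc hd,
      crosses_add_natCast p (by omega) (by omega) (by omega) (by omega)]
  have hdiag (e : Sym2 (ZMod m)) : IsDiagonal (e.map φ) ↔ IsDiagonal e ∨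
      e.map φ = s(p + ((0 : ℕ) : ZMod (m + 1)), p + ((m - 1 : ℕ) : ZMod (m + 1))) := by
    induction e with | _ x y
    obtain ⟨a, ha, rfl⟩ := exists_eq_add_natCast 0 x
    obtain ⟨b, hb, rfl⟩ := exists_eq_add_natCast 0 y
    rw [Sym2.map_mk, hφc ha, hφc hb, isDiagonal_add_natCast 0 ha hb,
      isDiagonal_add_natCast p (by omega) (by omega)]
    constructor
    · intro h
      by_cases h' : (a = 0 ∧ b = m - 1) ∨ (a = m - 1 ∧ b = 0)
      · rcases h' with ⟨rfl, rfl⟩ | ⟨rfl, rfl⟩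
        · exact Or.inr rfl
        · exact Or.inr Sym2.eq_swap
      · left
        omega
    · rintro (h | h)
      · omega
      · rcases Sym2.eq_iff.1 h with ⟨h₁, h₂⟩ | ⟨h₁, h₂⟩ <;>
        · have := add_natCast_injOn p (by omega) (by omega) h₁
          have := add_natCast_injOn p (by omega) (by omega) h₂
          omega
  have hearc (e : Sym2 (ZMod m)) : ¬ Crosses (e.map φ)
      s(p + ((0 : ℕ) : ZMod (m + 1)), p + ((m - 1 : ℕ) : ZMod (m + 1))) := by
    induction e with | _ x y
    obtain ⟨a, ha, rfl⟩ := exists_eq_add_natCast 0 x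
    obtain ⟨b, hb, rfl⟩ := exists_eq_add_natCast 0 y
    rw [Sym2.map_mk, hφc ha, hφc hb,
      crosses_add_natCast p (by omega) (by omega) (by omega) (by omega)]
    omega
  refine ⟨Sym2.map φ ⁻¹' B, ⟨fun e he => ?_, fun T hT => ?_⟩, ?_⟩
  · refine ((hdiag e).1 (hB.1 _ he)).resolve_right fun h => hi ?_
    rw [← h]
    exact he
  · have hT' : IsTriangulation (insert
        s(p + ((0 : ℕ) : ZMod (m + 1)), p + ((m - 1 : ℕ) : ZMod (m + 1)))
        (Sym2.map φ '' T)) := by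
      refine isTriangulation_of_forall_mem ?_ ?_ ?_
      · rintro _ (rfl | ⟨e, he, rfl⟩)
        · rw [isDiagonal_add_natCast p (by omega) (by omega)]
          omega
        · exact (hdiag e).2 (Or.inl (hT.1 e he))
      · rintro _ (rfl | ⟨e, he, rfl⟩) _ (rfl | ⟨f, hf, rfl⟩)
        · exact not_crosses_self _
        · exact fun h => hearc _ h.symm
        · exact hearc _
        · rw [hcross]
          exact hT.2.1 e he f hf
      · intro e he h
        obtain ⟨e, rfl⟩ : ∃ e', e = Sym2.map φ e' := by
          have h₀ := h _ (Or.inl rfl)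
          induction e with | _ x y
          obtain ⟨a, ha, rfl⟩ := exists_eq_add_natCast p x
          obtain ⟨b, hb, rfl⟩ := exists_eq_add_natCast p y
          rw [isDiagonal_add_natCast p ha hb] at he
          rw [crosses_add_natCast p ha hb (by omega) (by omega)] at h₀
          exact ⟨s(0 + (a : ZMod m), 0 + (b : ZMod m)), by
            rw [Sym2.map_mk, hφc (by omega), hφc (by omega)]⟩
        rcases (hdiag e).1 he with hd | hd
        · refine Or.inr ⟨e, hT.mem_of_forall_not_crosses hd fun f hf => ?_, rfl⟩
          rw [← hcross]
          exact h _ (Or.inr ⟨f, hf, rfl⟩)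
        · exact Or.inl hd
    obtain ⟨_, heB, rfl | ⟨e, he, rfl⟩⟩ := hB.2 _ hT'
    · exact absurd heB hi
    · exact ⟨e, heB, he⟩
  · refine Set.ncard_le_ncard_of_injOn (Sym2.map φ) (fun e he => ⟨he, fun hie => ?_⟩)
      (Sym2.map.injective hφ).injOn (Set.toFinite _)
    obtain ⟨x, -, hx⟩ := Sym2.mem_map.1 hie
    have := hlt x
    rw [hip] at hx
    have := add_natCast_injOn p (by omega) (by omega) hx
    omega

/-- A blocking set for the triangulations of the `n`-gon has at least `n - 2` elements. -/
lemma IsBlockingSet.le_ncard_add_two {n : ℕ} (hn : 3 ≤ n) {B : Set (Sym2 (ZMod n))}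
    (hB : IsBlockingSet B) : n ≤ B.ncard + 2 := by
  induction n, hn using Nat.le_induction with
  | base =>
    obtain ⟨e, he, -⟩ := hB.exists_mem 0
    have := (Set.ncard_pos (Set.toFinite B)).2 ⟨e, he⟩
    omega
  | succ m hm ih =>
    by_cases h : ∃ i : ZMod (m + 1), s(i - 1, i + 1) ∉ B
    · obtain ⟨i, hi⟩ := h
      obtain ⟨B', hB', hcard⟩ := hB.exists_of_ear_notMem hm hi
      obtain ⟨e, he, hie⟩ := hB.exists_mem i
      have hlt : {e ∈ B | i ∉ e}.ncard < B.ncard :=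
        Set.ncard_lt_ncard ⟨fun f hf => hf.1, fun hs => (hs he).2 hie⟩ (Set.toFinite _)
      have := ih hB'
      omega
    · push Not at h
      have hle : ((Finset.range (m - 1) : Finset ℕ) : Set ℕ).ncard ≤ B.ncard := by
        refine Set.ncard_le_ncard_of_injOn
          (fun k : ℕ => s((0 : ZMod (m + 1)) + (k : ZMod (m + 1)),
            (0 : ZMod (m + 1)) + ((k + 2 : ℕ) : ZMod (m + 1)))) (fun k _ => ?_)
          (fun k hk l hl hkl => ?_) (Set.toFinite _)
        · have hk := h ((k : ZMod (m + 1)) + 1)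
          rw [add_sub_cancel_right, add_assoc, one_add_one_eq_two] at hk
          simpa using hk
        · rw [Finset.coe_range, Set.mem_Iio] at hk hl
          rcases Sym2.eq_iff.1 hkl with ⟨h₁, -⟩ | ⟨h₁, h₂⟩
          · exact add_natCast_injOn 0 (by omega) (by omega) h₁
          · have := add_natCast_injOn 0 (by omega) (by omega) h₁
            have := add_natCast_injOn 0 (by omega) (by omega) h₂
            omega
      rw [Set.ncard_coe_finset, Finset.card_range] at hle
      omega

/-- If at least two diagonals of a blocker B have i as an endpoint,
then the ear-cover {i-1, i+1} belongs to B. -/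
theorem blocker_deg_two_ear {n : ℕ} (hn : 4 ≤ n)
    (B : Set (Sym2 (ZMod n))) (hB : IsBlocker B) (i : ZMod n)
    (h : ∃ e ∈ B, ∃ f ∈ B, e ≠ f ∧ i ∈ e ∧ i ∈ f) :
    s(i - 1, i + 1) ∈ B := by
  obtain ⟨m, rfl⟩ : ∃ m, n = m + 1 := ⟨n - 1, by omega⟩
  by_contra hi
  obtain ⟨e, he, f, hf, hef, hie, hif⟩ := h
  obtain ⟨B', hB', hcard⟩ := hB.1.exists_of_ear_notMem (by omega) hi
  obtain ⟨B₀, hB₀, hcard₀⟩ := exists_isBlockingSet_ncard_le (m := m) (by omega)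
  have h₁ := hB'.le_ncard_add_two (by omega)
  have h₂ := hB.2 B₀ hB₀
  have h₃ : {g ∈ B | i ∉ g}.ncard + ({e, f} : Set (Sym2 (ZMod (m + 1)))).ncard ≤ B.ncard := by
    rw [← Set.ncard_union_eq _ (Set.toFinite _) (Set.toFinite _)]
    · refine Set.ncard_le_ncard ?_ (Set.toFinite _)
      rintro g (hg | rfl | rfl)
      exacts [hg.1, he, hf]
    · rw [Set.disjoint_left]
      rintro g hg (rfl | rfl)
      exacts [hg.2 hie, hg.2 hif]
  rw [Set.ncard_pair hef] at h₃
  omega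

end ConvexBlockers
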